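/- arXiv:2605.18285 — 2 statements merged into one kernel-verified Lean document; each statement's English description precedes it below -/
import Mathlib

section
/- Let ρ be a pre-GSOS law of Σ over B, let f : X → Y be a morphism of C, and let ρ*_X and ρ*_Y be extensions of ρ at X and at Y. If ρ is natural w.r.t. Σ*f, i.e. B(Σ*(Σ*f)) ∘ ρ_{Σ*X} = ρ_{Σ*Y} ∘ Σ(Σ*f × B(Σ*f)), then B(Σ*f) ∘ ρ*_X = ρ*_Y ∘ Σ*(f × Bf). -/
open CategoryTheory CategoryTheory.Limits

universe v u

/-- Free algebras for an endofunctor `S`. -/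
structure FreeAlg {C : Type u} [Category.{v} C] (S : C ⥤ C) where
  obj : C → C
  ι : ∀ X : C, S.obj (obj X) ⟶ obj X
  η : ∀ X : C, X ⟶ obj X
  ext : ∀ {X A : C}, (S.obj A ⟶ A) → (X ⟶ A) → (obj X ⟶ A)
  ext_ι : ∀ {X A : C} (a : S.obj A ⟶ A) (h : X ⟶ A),
    ι X ≫ ext a h = S.map (ext a h) ≫ a
  ext_η : ∀ {X A : C} (a : S.obj A ⟶ A) (h : X ⟶ A), η X ≫ ext a h = h
  ext_unique : ∀ {X A : C} (a : S.obj A ⟶ A) (h : X ⟶ A) (k : obj X ⟶ A),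
    ι X ≫ k = S.map k ≫ a → η X ≫ k = h → k = ext a h

/-- The functorial action `Σ*f := (η_Y ∘ f)*`. -/
def FreeAlg.fmap {C : Type u} [Category.{v} C] {S : C ⥤ C} (F : FreeAlg S)
    {X Y : C} (f : X ⟶ Y) : F.obj X ⟶ F.obj Y :=
  F.ext (F.ι Y) (f ≫ F.η Y)

/-- The multiplication `μ^{Σ*}_X := (id_{Σ*X})* : Σ*(Σ*X) → Σ*X`. -/
def FreeAlg.mult {C : Type u} [Category.{v} C] {S : C ⥤ C} (F : FreeAlg S)
    (X : C) : F.obj (F.obj X) ⟶ F.obj X :=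
  F.ext (F.ι X) (𝟙 (F.obj X))

/-- `ρ*_X` is an extension of a pre-GSOS law `ρ` at `X` if
`ρ*_X ∘ η_{X×BX} = B(η_X) ∘ π₂` and
`ρ*_X ∘ ι_{X×BX} = B(μ^{Σ*}_X) ∘ ρ_{Σ*X} ∘ Σ⟨Σ*(π₁), ρ*_X⟩`. -/
def IsExtension {C : Type u} [Category.{v} C] [HasBinaryProducts C]
    {S B : C ⥤ C} (F : FreeAlg S)
    (rho : ∀ X : C, S.obj (X ⨯ B.obj X) ⟶ B.obj (F.obj X))
    (X : C) (rhoStar : F.obj (X ⨯ B.obj X) ⟶ B.obj (F.obj X)) : Prop :=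
  (F.η (X ⨯ B.obj X) ≫ rhoStar = prod.snd ≫ B.map (F.η X)) ∧
  (F.ι (X ⨯ B.obj X) ≫ rhoStar =
    S.map (prod.lift (F.fmap prod.fst) rhoStar) ≫ rho (F.obj X) ≫ B.map (F.mult X))

namespace FreeAlg

variable {C : Type u} [Category.{v} C] {S : C ⥤ C} (F : FreeAlg S)

/-- Algebra morphisms out of a free algebra that agree on generators are equal. -/
lemma hom_ext {X A : C} (a : S.obj A ⟶ A) {k l : F.obj X ⟶ A}
    (hk : F.ι X ≫ k = S.map k ≫ a) (hl : F.ι X ≫ l = S.map l ≫ a)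
    (h : F.η X ≫ k = F.η X ≫ l) : k = l :=
  (F.ext_unique a _ k hk h).trans (F.ext_unique a _ l hl rfl).symm

lemma ι_fmap {X Y : C} (f : X ⟶ Y) : F.ι X ≫ F.fmap f = S.map (F.fmap f) ≫ F.ι Y :=
  F.ext_ι _ _

lemma η_fmap {X Y : C} (f : X ⟶ Y) : F.η X ≫ F.fmap f = f ≫ F.η Y :=
  F.ext_η _ _

lemma ι_mult (X : C) : F.ι (F.obj X) ≫ F.mult X = S.map (F.mult X) ≫ F.ι X :=
  F.ext_ι _ _

lemma η_mult (X : C) : F.η (F.obj X) ≫ F.mult X = 𝟙 (F.obj X) :=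
  F.ext_η _ _

lemma ι_fmap_assoc {X Y Z : C} (f : X ⟶ Y) (g : F.obj Y ⟶ Z) :
    F.ι X ≫ F.fmap f ≫ g = S.map (F.fmap f) ≫ F.ι Y ≫ g := by
  rw [← Category.assoc, ι_fmap, Category.assoc]

lemma η_fmap_assoc {X Y Z : C} (f : X ⟶ Y) (g : F.obj Y ⟶ Z) :
    F.η X ≫ F.fmap f ≫ g = f ≫ F.η Y ≫ g := by
  rw [← Category.assoc, η_fmap, Category.assoc]

lemma mult_naturality {X Y : C} (f : X ⟶ Y) :
    F.mult X ≫ F.fmap f = F.fmap (F.fmap f) ≫ F.mult Y := by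
  apply F.hom_ext (F.ι Y)
  · rw [← Category.assoc, ι_mult, Category.assoc, ι_fmap, S.map_comp, Category.assoc]
  · rw [ι_fmap_assoc, ι_mult, S.map_comp, Category.assoc]
  · rw [← Category.assoc, η_mult, Category.id_comp, η_fmap_assoc, η_mult, Category.comp_id]

end FreeAlg

/-- If a pre-GSOS law `ρ` is natural w.r.t. `Σ*f`, then its extension `ρ*` is
natural w.r.t. `f`: `B(Σ*f) ∘ ρ*_X = ρ*_Y ∘ Σ*(f × Bf)`. -/
theorem stmt1 {C : Type u} [Category.{v} C] [HasBinaryProducts C]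
    (S B : C ⥤ C) (F : FreeAlg S)
    -- a pre-GSOS law of Σ over B (no naturality assumed)
    (rho : ∀ X : C, S.obj (X ⨯ B.obj X) ⟶ B.obj (F.obj X))
    {X Y : C} (f : X ⟶ Y)
    (rhoStarX : F.obj (X ⨯ B.obj X) ⟶ B.obj (F.obj X))
    (rhoStarY : F.obj (Y ⨯ B.obj Y) ⟶ B.obj (F.obj Y))
    (hX : IsExtension F rho X rhoStarX)
    (hY : IsExtension F rho Y rhoStarY)
    -- ρ is natural w.r.t. Σ*f
    (hnat : rho (F.obj X) ≫ B.map (F.fmap (F.fmap f)) =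
      S.map (prod.map (F.fmap f) (B.map (F.fmap f))) ≫ rho (F.obj Y)) :
    rhoStarX ≫ B.map (F.fmap f) = F.fmap (prod.map f (B.map f)) ≫ rhoStarY := by
  obtain ⟨hXη, hXι⟩ := hX
  obtain ⟨hYη, hYι⟩ := hY
  have key : prod.lift (F.fmap prod.fst ≫ F.fmap f) (rhoStarX ≫ B.map (F.fmap f)) =
      F.fmap (prod.map f (B.map f)) ≫ prod.lift (F.fmap prod.fst) rhoStarY := by
    apply F.hom_ext (prod.lift (S.map prod.fst ≫ F.ι Y) (rho (F.obj Y) ≫ B.map (F.mult Y)))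
    · ext
      · simp only [Category.assoc, prod.lift_fst, F.ι_fmap_assoc, F.ι_fmap]
        simp only [← Category.assoc, ← S.map_comp, prod.lift_fst]
      · have hmap : prod.lift (F.fmap prod.fst ≫ F.fmap f) (rhoStarX ≫ B.map (F.fmap f)) =
            prod.lift (F.fmap prod.fst) rhoStarX ≫
              prod.map (F.fmap f) (B.map (F.fmap f)) := by
          rw [prod.lift_map]
        simp only [Category.assoc, prod.lift_snd]
        rw [← Category.assoc, hXι, hmap, S.map_comp]
        simp only [Category.assoc]
        rw [← B.map_comp, F.mult_naturality, B.map_comp, ← Category.assoc (rho _), hnat, Category.assoc]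
    · ext
      · simp only [Category.assoc, prod.lift_fst, F.ι_fmap_assoc, F.ι_fmap]
        simp only [← Category.assoc, ← S.map_comp]
        simp only [Category.assoc, prod.lift_fst]
      · simp only [Category.assoc, prod.lift_snd, F.ι_fmap_assoc, hYι, S.map_comp]
    · ext
      · simp only [Category.assoc, prod.lift_fst, F.η_fmap_assoc, F.η_fmap, prod.map_fst_assoc]
      · simp only [Category.assoc, prod.lift_snd, F.η_fmap_assoc, hYη, prod.map_snd_assoc]
        rw [← Category.assoc, hXη, Category.assoc, ← B.map_comp, F.η_fmap, B.map_comp]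
  simpa only [Category.assoc, prod.lift_snd] using congrArg (· ≫ prod.snd) key
end

section
/- For every set R of De Simone rules, trace equivalence on the operational model is a congruence relation: for every operation symbol f of arity n and all closed terms t_1, …, t_n, s_1, …, s_n with tr(t_i) = tr(s_i) for i = 1, …, n, it holds that tr(f(t_1, …, t_n)) = tr(f(s_1, …, s_n)). -/
/-- Terms over a signature `(Op, ar)` with variables from `X`. -/
inductive FreeTerm (Op : Type) (ar : Op → ℕ) (X : Type) : Type
  | var : X → FreeTerm Op ar X
  | op : (f : Op) → (Fin (ar f) → FreeTerm Op ar X) → FreeTerm Op ar X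

/-- Closed terms over a signature `(Op, ar)`. -/
inductive Tm (Op : Type) (ar : Op → ℕ) : Type
  | op : (f : Op) → (Fin (ar f) → Tm Op ar) → Tm Op ar

/-- Number of occurrences of the variable `v` in a term. -/
def occ {Op : Type} {ar : Op → ℕ} {X : Type} [DecidableEq X] :
    FreeTerm Op ar X → X → ℕ
  | .var y, v => if y = v then 1 else 0
  | .op _ u, v => ∑ i, occ (u i) v

/-- Substitution of closed terms for variables. -/
def substC {Op : Type} {ar : Op → ℕ} {V : Type} (σ : V → Tm Op ar) :
    FreeTerm Op ar V → Tm Op ar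
  | .var v => σ v
  | .op f u => .op f (fun i => substC σ (u i))

/-- A De Simone rule for an `n`-ary operation `f`: premise positions `prem`,
premise labels `plab`, conclusion label `clab`, and an affine target term over the
variables `y_i` (`Sum.inl i`, for `i ∈ prem`) and `x_j` (`Sum.inr j`, for `j ∉ prem`). -/
structure DSRule (L Op : Type) (ar : Op → ℕ) (f : Op) where
  prem : Set (Fin (ar f))
  plab : Fin (ar f) → L
  clab : L
  target : FreeTerm Op ar (Fin (ar f) ⊕ Fin (ar f))
  wf_y : ∀ i, 0 < occ target (Sum.inl i) → i ∈ prem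
  wf_x : ∀ j, 0 < occ target (Sum.inr j) → j ∉ prem
  affine : ∀ v, occ target v ≤ 1

/-- The labelled transition relation inductively defined by a set `R` of
De Simone rules. -/
inductive Step {L Op : Type} {ar : Op → ℕ} (R : ∀ f : Op, Set (DSRule L Op ar f)) :
    Tm Op ar → L → Tm Op ar → Prop
  | mk {f : Op} {ts : Fin (ar f) → Tm Op ar} {r : DSRule L Op ar f}
      {ss : Fin (ar f) → Tm Op ar} :
      r ∈ R f →
      (∀ i ∈ r.prem, Step R (ts i) (r.plab i) (ss i)) →
      Step R (.op f ts) r.clab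
        (substC (fun v => match v with
          | Sum.inl i => ss i
          | Sum.inr j => ts j) r.target)

/-- `HasTrace R t w` : the word `w` is a (partial) trace of the closed term `t`. -/
inductive HasTrace {L Op : Type} {ar : Op → ℕ}
    (R : ∀ f : Op, Set (DSRule L Op ar f)) : Tm Op ar → List L → Prop
  | nil (t : Tm Op ar) : HasTrace R t []
  | cons {t : Tm Op ar} {a : L} {t' : Tm Op ar} {w : List L} :
      Step R t a t' → HasTrace R t' w → HasTrace R t (a :: w)

/-- Substitution of terms with variables for variables. -/
def FreeTerm.bind {Op : Type} {ar : Op → ℕ} {X V : Type} (τ : X → FreeTerm Op ar V) :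
    FreeTerm Op ar X → FreeTerm Op ar V
  | .var x => τ x
  | .op f u => .op f (fun i => (u i).bind τ)

theorem substC_bind {Op : Type} {ar : Op → ℕ} {X V : Type} (σ : V → Tm Op ar)
    (τ : X → FreeTerm Op ar V) (E : FreeTerm Op ar X) :
    substC σ (E.bind τ) = substC (fun x => substC σ (τ x)) E := by
  induction E with
  | var x => rfl
  | op f u ih => simp only [FreeTerm.bind, substC, ih]

theorem occ_le_occ_op {Op : Type} {ar : Op → ℕ} {V : Type} [DecidableEq V] {f : Op}
    (u : Fin (ar f) → FreeTerm Op ar V) (i : Fin (ar f)) (v : V) :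
    occ (u i) v ≤ occ (.op f u) v :=
  Finset.single_le_sum (f := fun i => occ (u i) v) (fun _ _ => Nat.zero_le _)
    (Finset.mem_univ i)

theorem substC_congr {Op : Type} {ar : Op → ℕ} {V : Type} [DecidableEq V]
    {σ σ' : V → Tm Op ar} {E : FreeTerm Op ar V}
    (h : ∀ v, 0 < occ E v → σ v = σ' v) : substC σ E = substC σ' E := by
  induction E with
  | var x => exact h x (by simp [occ])
  | op f u ih =>
    simp only [substC, Tm.op.injEq, heq_eq_eq, true_and]
    funext i
    exact ih i fun v hv => h v (hv.trans_le (occ_le_occ_op u i v))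

theorem occ_bind {Op : Type} {ar : Op → ℕ} {X V : Type} [DecidableEq X] [Fintype X]
    [DecidableEq V] (τ : X → FreeTerm Op ar V) (E : FreeTerm Op ar X) (v : V) :
    occ (E.bind τ) v = ∑ x, occ E x * occ (τ x) v := by
  induction E with
  | var x => simp [FreeTerm.bind, occ]
  | op f u ih =>
    simp only [FreeTerm.bind, occ, ih, Finset.sum_mul]
    exact Finset.sum_comm

theorem eq_of_occ_op_le_one {Op : Type} {ar : Op → ℕ} {V : Type} [DecidableEq V] {f : Op}
    {u : Fin (ar f) → FreeTerm Op ar V} {v : V} (h : occ (.op f u) v ≤ 1)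
    {i j : Fin (ar f)} (hi : 0 < occ (u i) v) (hj : 0 < occ (u j) v) : i = j := by
  by_contra hij
  have hle : ∑ k ∈ {i, j}, occ (u k) v ≤ occ (.op f u) v :=
    Finset.sum_le_sum_of_subset (Finset.subset_univ _)
  rw [Finset.sum_pair hij] at hle
  omega

/-- The second process is reached from the first by an optional transition: none if the label is absent,
a single one if it is present. -/
def OptStep {L Op : Type} {ar : Op → ℕ} (R : ∀ f : Op, Set (DSRule L Op ar f)) (t : Tm Op ar) :
    Option L → Tm Op ar → Prop
  | none, t' => t' = t
  | some a, t' => Step R t a t'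

theorem Step.of_rule {L Op : Type} {ar : Op → ℕ} {R : ∀ f : Op, Set (DSRule L Op ar f)}
    {f : Op} {r : DSRule L Op ar f} (hr : r ∈ R f) {ts ss : Fin (ar f) → Tm Op ar}
    (h : ∀ i ∈ r.prem, Step R (ts i) (r.plab i) (ss i)) {ρ : Fin (ar f) ⊕ Fin (ar f) → Tm Op ar}
    (hy : ∀ i ∈ r.prem, ρ (.inl i) = ss i) (hx : ∀ j ∉ r.prem, ρ (.inr j) = ts j) :
    Step R (.op f ts) r.clab (substC ρ r.target) := by
  convert Step.mk hr h using 1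
  refine substC_congr fun v hv => ?_
  rcases v with i | j
  · exact hy i (r.wf_y i hv)
  · exact hx j (r.wf_x j hv)

/-- The target of a rule, with its variables replaced by terms in which every variable occurs at
most as often as in the corresponding argument, has at most the occurrences of the source. -/
theorem occ_target_bind_le {L Op : Type} {ar : Op → ℕ} {V : Type} [DecidableEq V] {f : Op}
    (r : DSRule L Op ar f) {u u' : Fin (ar f) → FreeTerm Op ar V} {v : V}
    (h : ∀ i ∈ r.prem, occ (u' i) v ≤ occ (u i) v) :
    occ (r.target.bind (Sum.elim u' u)) v ≤ occ (.op f u) v := by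
  rw [occ_bind, Fintype.sum_sum_type, ← Finset.sum_add_distrib]
  refine Finset.sum_le_sum fun i _ => ?_
  simp only [Sum.elim_inl, Sum.elim_inr]
  by_cases hi : i ∈ r.prem
  · have h0 : occ r.target (.inr i) = 0 := by
      by_contra h0
      exact r.wf_x i (Nat.pos_of_ne_zero h0) hi
    rw [h0, zero_mul, add_zero]
    exact (Nat.mul_le_mul (r.affine _) (h i hi)).trans (one_mul _).le
  · have h0 : occ r.target (.inl i) = 0 := by
      by_contra h0
      exact hi (r.wf_y i (Nat.pos_of_ne_zero h0))
    rw [h0, zero_mul, zero_add]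
    exact (Nat.mul_le_mul_right _ (r.affine _)).trans (one_mul _).le

/-- A transition of an instance of an affine term arises from at most one transition of each of
the substituted processes, uniformly in these processes. -/
theorem Step.exists_optStep {L Op : Type} {ar : Op → ℕ} {R : ∀ f : Op, Set (DSRule L Op ar f)}
    {V : Type} [DecidableEq V] {E : FreeTerm Op ar V} (hE : ∀ v, occ E v ≤ 1)
    {σ : V → Tm Op ar} {a : L} {t : Tm Op ar} (h : Step R (substC σ E) a t) :
    ∃ (d : V → Option L) (E' : FreeTerm Op ar V) (σ₁ : V → Tm Op ar),
      (∀ v, occ E' v ≤ occ E v) ∧ (∀ v, OptStep R (σ v) (d v) (σ₁ v)) ∧ t = substC σ₁ E' ∧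
      ∀ ρ ρ₁ : V → Tm Op ar, (∀ v, 0 < occ E v → OptStep R (ρ v) (d v) (ρ₁ v)) →
        Step R (substC ρ E) a (substC ρ₁ E') := by
  classical
  induction E generalizing a t with
  | var x =>
    refine ⟨fun v => if v = x then some a else none, .var x, Function.update σ x t,
      fun _ => le_rfl, fun v => ?_, by simp [substC], fun ρ ρ₁ hρ => ?_⟩
    · by_cases hv : v = x
      · subst hv
        simpa [OptStep, substC] using h
      · simp [OptStep, hv]
    · simpa [OptStep, substC] using hρ x (by simp [occ])
  | op f u ih =>
    rw [substC] at h
    cases h with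
    | @mk _ _ r ss hr hp =>
    have aux : ∀ i, ∃ (d : V → Option L) (E' : FreeTerm Op ar V) (σ₁ : V → Tm Op ar),
        i ∈ r.prem → (∀ v, occ E' v ≤ occ (u i) v) ∧ (∀ v, OptStep R (σ v) (d v) (σ₁ v)) ∧
          ss i = substC σ₁ E' ∧
          ∀ ρ ρ₁ : V → Tm Op ar, (∀ v, 0 < occ (u i) v → OptStep R (ρ v) (d v) (ρ₁ v)) →
            Step R (substC ρ (u i)) (r.plab i) (substC ρ₁ E') := by
      intro i
      by_cases hi : i ∈ r.prem
      · obtain ⟨d, E', σ₁, H⟩ := ih i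
          (fun v => (occ_le_occ_op u i v).trans (hE v)) (hp i hi)
        exact ⟨d, E', σ₁, fun _ => H⟩
      · exact ⟨fun _ => none, u i, σ, fun hi' => absurd hi' hi⟩
    choose d E' σ₁ H using aux
    let D : V → Option L := fun v =>
      if hv : ∃ i ∈ r.prem, 0 < occ (u i) v then d hv.choose v else none
    let S : V → Tm Op ar := fun v =>
      if hv : ∃ i ∈ r.prem, 0 < occ (u i) v then σ₁ hv.choose v else σ v
    have prem_eq : ∀ i ∈ r.prem, ∀ v, 0 < occ (u i) v → D v = d i v ∧ S v = σ₁ i v := by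
      intro i hi v hv
      have hex : ∃ i ∈ r.prem, 0 < occ (u i) v := ⟨i, hi, hv⟩
      have heq := eq_of_occ_op_le_one (hE v) hex.choose_spec.2 hv
      simp only [D, S, dif_pos hex, heq, and_self]
    have nonprem_eq : ∀ j ∉ r.prem, ∀ v, 0 < occ (u j) v → D v = none ∧ S v = σ v := by
      intro j hj v hv
      have hex : ¬ ∃ i ∈ r.prem, 0 < occ (u i) v := by
        rintro ⟨i, hi, hiv⟩
        exact hj (eq_of_occ_op_le_one (hE v) hiv hv ▸ hi)
      simp only [D, S, dif_neg hex, and_self]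
    refine ⟨D, r.target.bind (Sum.elim E' u), S,
      fun v => occ_target_bind_le r fun i hi => (H i hi).1 v, fun v => ?_, ?_, fun ρ ρ₁ hρ => ?_⟩
    · by_cases hex : ∃ i ∈ r.prem, 0 < occ (u i) v
      · simpa only [D, S, dif_pos hex] using (H _ hex.choose_spec.1).2.1 v
      · simp only [D, S, dif_neg hex, OptStep]
    · rw [substC_bind]
      refine substC_congr fun v hv => ?_
      rcases v with i | j
      · have hi := r.wf_y i hv
        exact (H i hi).2.2.1.trans (substC_congr fun v hv =>
          (prem_eq i hi v (hv.trans_le ((H i hi).1 v))).2.symm)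
      · exact substC_congr fun x hx => (nonprem_eq j (r.wf_x j hv) x hx).2.symm
    · rw [substC_bind]
      refine Step.of_rule (ss := fun i => substC ρ₁ (E' i)) hr (fun i hi => ?_)
        (fun i _ => rfl) (fun j hj => ?_)
      · refine (H i hi).2.2.2 ρ ρ₁ fun v hv => ?_
        rw [← (prem_eq i hi v hv).1]
        exact hρ v (hv.trans_le (occ_le_occ_op u _ v))
      · refine substC_congr fun v hv => ?_
        have hv' := hρ v (hv.trans_le (occ_le_occ_op u _ v))
        rwa [(nonprem_eq j hj v hv).1] at hv'

theorem OptStep.hasTrace {L Op : Type} {ar : Op → ℕ} {R : ∀ f : Op, Set (DSRule L Op ar f)}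
    {t t' : Tm Op ar} {o : Option L} {w : List L} (h : OptStep R t o t') (hw : HasTrace R t' w) :
    HasTrace R t (o.toList ++ w) := by
  cases o with
  | none => exact (show t' = t from h) ▸ hw
  | some a => exact .cons h hw

theorem HasTrace.exists_optStep {L Op : Type} {ar : Op → ℕ}
    {R : ∀ f : Op, Set (DSRule L Op ar f)} {t : Tm Op ar} {o : Option L} {w : List L}
    (h : HasTrace R t (o.toList ++ w)) : ∃ t', OptStep R t o t' ∧ HasTrace R t' w := by
  cases o with
  | none => exact ⟨t, rfl, h⟩
  | some a =>
    cases h with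
    | cons hs hw => exact ⟨_, hs, hw⟩

/-- A trace of an instance of an affine term is determined by one trace of each of the
substituted processes. -/
theorem HasTrace.exists_traces {L Op : Type} {ar : Op → ℕ}
    {R : ∀ f : Op, Set (DSRule L Op ar f)} {V : Type} [DecidableEq V]
    {E : FreeTerm Op ar V} (hE : ∀ v, occ E v ≤ 1) {σ : V → Tm Op ar} {w : List L}
    (h : HasTrace R (substC σ E) w) :
    ∃ u : V → List L, (∀ v, HasTrace R (σ v) (u v)) ∧
      ∀ ρ : V → Tm Op ar, (∀ v, HasTrace R (ρ v) (u v)) → HasTrace R (substC ρ E) w := by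
  induction w generalizing E σ with
  | nil => exact ⟨fun _ => [], fun _ => .nil _, fun _ _ => .nil _⟩
  | cons a w ih =>
    cases h with
    | cons hs hw =>
    obtain ⟨d, E', σ₁, hocc, hd, rfl, hstep⟩ := hs.exists_optStep hE
    obtain ⟨u, hu, hρ⟩ := ih (fun v => (hocc v).trans (hE v)) hw
    refine ⟨fun v => (d v).toList ++ u v, fun v => (hd v).hasTrace (hu v), fun ρ h => ?_⟩
    choose ρ₁ hρ₁ using fun v => (h v).exists_optStep
    exact .cons (hstep ρ ρ₁ fun v _ => (hρ₁ v).1) (hρ ρ₁ fun v => (hρ₁ v).2)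

theorem HasTrace.op_of_forall {L Op : Type} {ar : Op → ℕ}
    {R : ∀ f : Op, Set (DSRule L Op ar f)} {f : Op} {ts ss : Fin (ar f) → Tm Op ar}
    (h : ∀ i w, HasTrace R (ts i) w → HasTrace R (ss i) w) {w : List L}
    (hw : HasTrace R (.op f ts) w) : HasTrace R (.op f ss) w := by
  obtain ⟨u, hu, hρ⟩ := HasTrace.exists_traces (E := .op f .var) (σ := ts)
    (fun v => by simp [occ]) hw
  exact hρ ss fun i => h i _ (hu i)

/-- **Compositionality of De Simone rules.**
For every set of De Simone rules, trace equivalence on the operational model is a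
congruence relation. -/
theorem stmt15 {L Op : Type} {ar : Op → ℕ}
    (R : ∀ f : Op, Set (DSRule L Op ar f))
    (f : Op) (ts ss : Fin (ar f) → Tm Op ar)
    (h : ∀ i, { w : List L | HasTrace R (ts i) w } = { w : List L | HasTrace R (ss i) w }) :
    { w : List L | HasTrace R (.op f ts) w } =
      { w : List L | HasTrace R (.op f ss) w } := by
  ext w
  exact ⟨HasTrace.op_of_forall fun i w => (Set.ext_iff.mp (h i) w).mp,
    HasTrace.op_of_forall fun i w => (Set.ext_iff.mp (h i) w).mpr⟩
end
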